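/- Let K be a convex body in ℝ⁵ and let λ ∈ [0,1]. Then vol((1−λ)K + λ(−K)) ≤ (Σ_{j=0}^{5} binom(5,j)² λ^j (1−λ)^{5−j}) · vol(K), i.e. vol((1−λ)K + λ(−K)) ≤ ((1−λ)⁵ + 25λ(1−λ)⁴ + 100λ²(1−λ)³ + 100λ³(1−λ)² + 25λ⁴(1−λ) + λ⁵) · vol(K). -/

import Mathlib

open MeasureTheory Set Pointwise
open scoped ENNReal

section NearestPoint

variable {E : Type*} [NormedAddCommGroup E] [InnerProductSpace ℝ E] {K L : Set E} {P Q : E → E}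

/-- `P` sends every point to its nearest point in the convex set `K`, expressed through the
variational inequality. -/
def IsNearestPointMap (K : Set E) (P : E → E) : Prop :=
  ∀ x, P x ∈ K ∧ ∀ k ∈ K, inner ℝ (x - P x) (k - P x) ≤ 0

theorem exists_isNearestPointMap (hne : K.Nonempty) (hc : IsComplete K) (hK : Convex ℝ K) :
    ∃ P, IsNearestPointMap K P := by
  have h (x : E) : ∃ p, p ∈ K ∧ ∀ k ∈ K, inner ℝ (x - p) (k - p) ≤ 0 := by
    obtain ⟨p, hp, hpx⟩ := exists_norm_eq_iInf_of_complete_convex hne hc hK x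
    exact ⟨p, hp, (norm_eq_iInf_iff_real_inner_le_zero hK hp).1 hpx⟩
  choose P hP using h
  exact ⟨P, hP⟩

theorem norm_sub_sq_le_of_inner_le {x y p q : E} (hp : p ∈ K) (hq : q ∈ K)
    (hpx : ∀ k ∈ K, inner ℝ (x - p) (k - p) ≤ 0) (hqy : ∀ k ∈ K, inner ℝ (y - q) (k - q) ≤ 0) :
    ‖p - q‖ ^ 2 ≤ inner ℝ (p - q) (x - y) := by
  have h1 := hpx q hq
  have h2 := hqy p hp
  rw [← real_inner_self_eq_norm_sq]
  simp only [inner_sub_left, inner_sub_right] at *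
  linarith [real_inner_comm x p, real_inner_comm x q, real_inner_comm y p, real_inner_comm y q,
    real_inner_comm p q]

namespace IsNearestPointMap

theorem norm_sub_sq_le (hP : IsNearestPointMap K P) (x y : E) :
    ‖P x - P y‖ ^ 2 ≤ inner ℝ (P x - P y) (x - y) :=
  norm_sub_sq_le_of_inner_le (hP x).1 (hP y).1 (hP x).2 (hP y).2

theorem inner_sub_nonneg (hP : IsNearestPointMap K P) (x y : E) :
    0 ≤ inner ℝ (P x - P y) (x - y) :=
  (sq_nonneg _).trans (hP.norm_sub_sq_le x y)

theorem lipschitzWith (hP : IsNearestPointMap K P) : LipschitzWith 1 P := by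
  refine LipschitzWith.of_dist_le_mul fun x y => ?_
  rw [dist_eq_norm, dist_eq_norm, NNReal.coe_one, one_mul]
  have h := (hP.norm_sub_sq_le x y).trans (real_inner_le_norm _ _)
  nlinarith [norm_nonneg (P x - P y), norm_nonneg (x - y)]

theorem eq_of_inner_le (hP : IsNearestPointMap K P) {x p : E} (hp : p ∈ K)
    (h : ∀ k ∈ K, inner ℝ (x - p) (k - p) ≤ 0) : P x = p := by
  have := norm_sub_sq_le_of_inner_le (hP x).1 hp (hP x).2 h
  rw [sub_self, inner_zero_right] at this
  exact sub_eq_zero.1 (norm_eq_zero.1 (by nlinarith [norm_nonneg (P x - p)]))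

theorem apply_lineMap_eq (hP : IsNearestPointMap K P) {x y : E} (h : P x = P y) {r : ℝ}
    (hr : r ∈ Icc (0 : ℝ) 1) : P (x + r • (y - x)) = P x := by
  refine hP.eq_of_inner_le (hP x).1 fun k hk => ?_
  have h1 := (hP x).2 k hk
  have h2 := (hP y).2 k hk
  rw [← h] at h2
  have h3 : x + r • (y - x) - P x = (1 - r) • (x - P x) + r • (y - P x) := by module
  rw [h3, inner_add_left, real_inner_smul_left, real_inner_smul_left]
  nlinarith [hr.1, hr.2]

/-- The Moreau envelope potential dominates each affine function coming from a point of `K`. -/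
theorem inner_sub_le (hP : IsNearestPointMap K P) (x : E) {k : E} (hk : k ∈ K) :
    inner ℝ x k - ‖k‖ ^ 2 / 2 ≤ inner ℝ x (P x) - ‖P x‖ ^ 2 / 2 := by
  have h1 := (hP x).2 k hk
  have h2 := sq_nonneg ‖k - P x‖
  rw [← real_inner_self_eq_norm_sq] at h2 ⊢
  rw [← real_inner_self_eq_norm_sq]
  simp only [inner_sub_left, inner_sub_right] at *
  linarith [real_inner_comm k (P x)]

theorem inner_fderiv_nonneg (hP : IsNearestPointMap K P) {x : E} (hx : DifferentiableAt ℝ P x)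
    (v : E) : 0 ≤ inner ℝ (fderiv ℝ P x v) v := by
  have hline : HasDerivAt (fun r : ℝ => x + r • v) v 0 := by
    simpa using ((hasDerivAt_id (0 : ℝ)).smul_const v).const_add x
  have h1 : HasDerivAt (fun r : ℝ => P (x + r • v)) (fderiv ℝ P x v) 0 := by
    have hx' : HasFDerivAt P (fderiv ℝ P x) (x + (0 : ℝ) • v) := by simpa using hx.hasFDerivAt
    exact hx'.comp_hasDerivAt (0 : ℝ) hline
  have h2 : HasDerivAt (fun r : ℝ => inner ℝ (P (x + r • v)) v) (inner ℝ (fderiv ℝ P x v) v) 0 := by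
    simpa using h1.inner ℝ (hasDerivAt_const (0 : ℝ) v)
  have hmono : Monotone fun r : ℝ => inner ℝ (P (x + r • v)) v := by
    intro a b hab
    rcases hab.eq_or_lt with rfl | hab
    · exact le_rfl
    have h := hP.inner_sub_nonneg (x + b • v) (x + a • v)
    have e : x + b • v - (x + a • v) = (b - a) • v := by module
    rw [e, real_inner_smul_right, inner_sub_left] at h
    exact sub_nonneg.1 (nonneg_of_mul_nonneg_right h (sub_pos.2 hab))
  rw [← h2.deriv]
  exact hmono.deriv_nonneg

theorem range_subset (hP : IsNearestPointMap K P) (hQ : IsNearestPointMap L Q) (t : ℝ) :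
    range (fun x => P x + t • Q x) ⊆ K + t • L := by
  rintro _ ⟨x, rfl⟩
  exact add_mem_add (hP x).1 (smul_mem_smul_set (hQ x).1)

theorem interior_subset_range [ProperSpace E] (hP : IsNearestPointMap K P)
    (hQ : IsNearestPointMap L Q) (hKb : Bornology.IsBounded K) (hLb : Bornology.IsBounded L)
    {t : ℝ} (ht : 0 < t) :
    interior (K + t • L) ⊆ range (fun x => P x + t • Q x) := by
  intro y hy
  obtain ⟨r, hr, hball⟩ := Metric.nhds_basis_closedBall.mem_iff.1 (mem_interior_iff_mem_nhds.1 hy)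
  obtain ⟨A, hA⟩ := hKb.exists_norm_le
  obtain ⟨B, hB⟩ := hLb.exists_norm_le
  have hPc := hP.lipschitzWith.continuous
  have hQc := hQ.lipschitzWith.continuous
  set F : E → ℝ := fun x => (inner ℝ x (P x) - ‖P x‖ ^ 2 / 2)
    + t * (inner ℝ x (Q x) - ‖Q x‖ ^ 2 / 2) - inner ℝ x y with hF
  have hFc : Continuous F := by fun_prop
  have hlow : ∀ x, r * ‖x‖ - (A ^ 2 / 2 + t * (B ^ 2 / 2)) ≤ F x := by
    intro x
    have hmem : y + (r * ‖x‖⁻¹) • x ∈ K + t • L := by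
      refine hball ?_
      rw [mem_closedBall_iff_norm, add_sub_cancel_left, norm_smul,
        Real.norm_of_nonneg (by positivity), mul_assoc]
      rcases eq_or_ne ‖x‖ 0 with h | h
      · simp [h, hr.le]
      · rw [inv_mul_cancel₀ h, mul_one]
    obtain ⟨k, hk, _, ⟨l, hl, rfl⟩, hkl⟩ := hmem
    have e : inner ℝ x (k + t • l) = inner ℝ x y + r * ‖x‖ := by
      have : k + t • l = y + (r * ‖x‖⁻¹) • x := hkl
      rw [this, inner_add_right, real_inner_smul_right, real_inner_self_eq_norm_sq]
      rcases eq_or_ne ‖x‖ 0 with h | h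
      · simp [h]
      · field_simp
    rw [inner_add_right, real_inner_smul_right] at e
    have h1 := hP.inner_sub_le x hk
    have h2 := mul_le_mul_of_nonneg_left (hQ.inner_sub_le x hl) ht.le
    have h3 : ‖k‖ ^ 2 ≤ A ^ 2 := pow_le_pow_left₀ (norm_nonneg _) (hA k hk) 2
    have h4 : t * ‖l‖ ^ 2 ≤ t * B ^ 2 :=
      mul_le_mul_of_nonneg_left (pow_le_pow_left₀ (norm_nonneg _) (hB l hl) 2) ht.le
    simp only [hF]
    linarith
  have hlim : Filter.Tendsto F (Filter.cocompact E) Filter.atTop := by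
    refine Filter.tendsto_atTop_mono hlow ?_
    exact Filter.tendsto_atTop_add_const_right _ _
      ((tendsto_norm_cocompact_atTop (E := E)).const_mul_atTop hr)
  obtain ⟨x, hx⟩ := hFc.exists_forall_le hlim
  refine ⟨x, ?_⟩
  set w := P x + t • Q x - y with hw
  have hle : ∀ s : ℝ, 0 < s → inner ℝ (P (x - s • w) + t • Q (x - s • w) - y) w ≤ 0 := by
    intro s hs
    have h0 := hx (x - s • w)
    have h1 := hP.inner_sub_le x (hP (x - s • w)).1
    have h2 := mul_le_mul_of_nonneg_left (hQ.inner_sub_le x (hQ (x - s • w)).1) ht.le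
    simp only [hF] at h0
    set p := P (x - s • w)
    set q := Q (x - s • w)
    simp only [inner_sub_left, inner_add_left, real_inner_smul_left] at h0 h1 h2 ⊢
    have h3 : s * (inner ℝ w p + t * inner ℝ w q - inner ℝ w y) ≤ 0 := by linarith
    rw [real_inner_comm w p, real_inner_comm w q, real_inner_comm w y]
    exact nonpos_of_mul_nonpos_right h3 hs
  have hcont : Continuous fun s : ℝ => inner ℝ (P (x - s • w) + t • Q (x - s • w) - y) w := by
    fun_prop
  have hlim0 : inner ℝ w w ≤ 0 := by
    have h := (hcont.tendsto 0).mono_left (nhdsWithin_le_nhds (s := Ioi 0))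
    simp only [zero_smul, sub_zero, ← hw] at h
    exact le_of_tendsto h (Filter.eventually_of_mem self_mem_nhdsWithin hle)
  exact sub_eq_zero.1 (real_inner_self_nonpos.1 hlim0)

end IsNearestPointMap

end NearestPoint

section MixedVolume

variable {E : Type*} [NormedAddCommGroup E] [InnerProductSpace ℝ E] [FiniteDimensional ℝ E]

theorem ContinuousLinearMap.det_nonneg_of_inner_nonneg (M : E →L[ℝ] E)
    (hM : ∀ v, 0 ≤ inner ℝ (M v) v) : 0 ≤ M.det := by
  by_contra! hneg
  set g : ℝ → ℝ := fun r => ((1 - r) • M + r • ContinuousLinearMap.id ℝ E).det with hg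
  have hgc : Continuous g := by
    refine ContinuousLinearMap.continuous_det.comp ?_
    fun_prop
  have h0 : g 0 < 0 := by simpa [hg] using hneg
  have h1 : 0 < g 1 := by simp [hg, ContinuousLinearMap.det]
  obtain ⟨r, hr, hr0⟩ := intermediate_value_Icc zero_le_one hgc.continuousOn ⟨h0.le, h1.le⟩
  have hrpos : 0 < r := hr.1.lt_of_ne (by rintro rfl; exact h0.ne hr0)
  obtain ⟨v, hv0, hv⟩ := Submodule.exists_mem_ne_zero_of_ne_bot
    (LinearMap.bot_lt_ker_of_det_eq_zero hr0).ne'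
  have h2 : inner ℝ ((1 - r) • M v + r • v) v = 0 := by
    have : (1 - r) • M v + r • v = 0 := hv0
    rw [this, inner_zero_left]
  rw [inner_add_left, real_inner_smul_left, real_inner_smul_left] at h2
  nlinarith [mul_nonneg (sub_nonneg.2 hr.2) (hM v), mul_pos hrpos (real_inner_self_pos.2 hv)]

theorem ContinuousLinearMap.exists_polynomial_det_add_smul (A B : E →L[ℝ] E) :
    ∃ q : Polynomial ℝ, q.natDegree ≤ Module.finrank ℝ E ∧ ∀ t : ℝ, q.eval t = (A + t • B).det := by
  let b := Module.finBasis ℝ E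
  refine ⟨_, (Polynomial.natDegree_det_X_add_C_le (LinearMap.toMatrix b b B)
    (LinearMap.toMatrix b b A)).trans_eq (Fintype.card_fin _), fun t => ?_⟩
  rw [ContinuousLinearMap.det, ← LinearMap.det_toMatrix b, ← Polynomial.coe_evalRingHom,
    RingHom.map_det]
  congr 1
  ext i j
  simp [LinearMap.toMatrix_apply]
  ring

theorem LipschitzWith.addHaar_image_eq_zero [MeasurableSpace E] [BorelSpace E] (μ : Measure E)
    [μ.IsAddHaarMeasure] {f : E → E} {C : NNReal} (hf : LipschitzWith C f) {s : Set E}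
    (hs : μ s = 0) : μ (f '' s) = 0 := by
  have hs' : Measure.hausdorffMeasure (Module.finrank ℝ E) s = 0 :=
    Measure.absolutelyContinuous_isAddHaarMeasure _ μ hs
  refine Measure.absolutelyContinuous_isAddHaarMeasure μ
    (Measure.hausdorffMeasure (Module.finrank ℝ E)) ?_
  have h := hf.hausdorffMeasure_image_le (Nat.cast_nonneg (Module.finrank ℝ E)) s
  rwa [hs', mul_zero, nonpos_iff_eq_zero] at h

theorem IsNearestPointMap.det_fderiv_add_smul_nonneg {K L : Set E} {P Q : E → E}
    (hP : IsNearestPointMap K P) (hQ : IsNearestPointMap L Q) {x : E}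
    (hPx : DifferentiableAt ℝ P x) (hQx : DifferentiableAt ℝ Q x) {t : ℝ} (ht : 0 ≤ t) :
    0 ≤ (fderiv ℝ P x + t • fderiv ℝ Q x).det := by
  refine ContinuousLinearMap.det_nonneg_of_inner_nonneg _ fun v => ?_
  simp only [add_apply, smul_apply, inner_add_left, real_inner_smul_left]
  exact add_nonneg (hP.inner_fderiv_nonneg hPx v) (mul_nonneg ht (hQ.inner_fderiv_nonneg hQx v))

theorem IsNearestPointMap.addHaar_add_smul_eq_lintegral [MeasurableSpace E] [BorelSpace E]
    (μ : Measure E) [μ.IsAddHaarMeasure] {K L : Set E} {P Q : E → E} (hP : IsNearestPointMap K P)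
    (hQ : IsNearestPointMap L Q) (hKb : Bornology.IsBounded K) (hLb : Bornology.IsBounded L)
    (hKc : Convex ℝ K) (hLc : Convex ℝ L) {t : ℝ} (ht : 0 < t) :
    μ (K + t • L) = ∫⁻ x, ENNReal.ofReal (fderiv ℝ P x + t • fderiv ℝ Q x).det ∂μ := by
  set T : E → E := fun x => P x + t • Q x with hT
  set T' : E → E →L[ℝ] E := fun x => fderiv ℝ P x + t • fderiv ℝ Q x with hT'
  have hT'm : Measurable fun x => (T' x).det :=
    ContinuousLinearMap.continuous_det.measurable.comp
      ((measurable_fderiv ℝ P).add ((measurable_fderiv ℝ Q).const_smul t))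
  set D : Set E := {x | DifferentiableAt ℝ P x} ∩ {x | DifferentiableAt ℝ Q x} with hD
  have hDm : MeasurableSet D :=
    (measurableSet_of_differentiableAt ℝ P).inter (measurableSet_of_differentiableAt ℝ Q)
  have hDae : ∀ᵐ x ∂μ, x ∈ D := by
    filter_upwards [hP.lipschitzWith.ae_differentiableAt (μ := μ),
      hQ.lipschitzWith.ae_differentiableAt (μ := μ)] with x h1 h2 using ⟨h1, h2⟩
  have hderiv : ∀ x ∈ D, HasFDerivAt T (T' x) x := fun x hx =>
    hx.1.hasFDerivAt.add (hx.2.hasFDerivAt.const_smul t)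
  have hdet : ∀ x ∈ D, 0 ≤ (T' x).det := fun x hx =>
    hP.det_fderiv_add_smul_nonneg hQ hx.1 hx.2 ht.le
  set G : Set E := D ∩ {x | (T' x).det ≠ 0} with hG
  have hGm : MeasurableSet G := hDm.inter (hT'm (measurableSet_singleton 0).compl)
  have hinj : InjOn T G := by
    intro x hx y hy hxy
    by_contra hne
    have h1 := hP.norm_sub_sq_le x y
    have h2 := mul_le_mul_of_nonneg_left (hQ.norm_sub_sq_le x y) ht.le
    have h3 : inner ℝ (P x - P y) (x - y) + t * inner ℝ (Q x - Q y) (x - y) = 0 := by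
      have : (P x - P y) + t • (Q x - Q y) = 0 := by
        rw [← sub_eq_zero] at hxy
        rw [← hxy]
        simp only [hT]
        module
      rw [← real_inner_smul_left, ← inner_add_left, this, inner_zero_left]
    have h4 : P x = P y := by
      refine sub_eq_zero.1 (norm_eq_zero.1 (pow_eq_zero_iff two_ne_zero |>.1 ?_))
      exact le_antisymm (by nlinarith [mul_nonneg ht.le (sq_nonneg ‖Q x - Q y‖)]) (sq_nonneg _)
    have h5 : Q x = Q y := by
      refine sub_eq_zero.1 (norm_eq_zero.1 (pow_eq_zero_iff two_ne_zero |>.1 ?_))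
      refine le_antisymm ?_ (sq_nonneg _)
      by_contra! hpos
      nlinarith [mul_pos ht hpos, sq_nonneg ‖P x - P y‖]
    have hline : HasDerivAt (fun r : ℝ => x + r • (y - x)) (y - x) 0 := by
      simpa using ((hasDerivAt_id (0 : ℝ)).smul_const (y - x)).const_add x
    have h6 : HasDerivAt (fun r : ℝ => T (x + r • (y - x))) (T' x (y - x)) 0 := by
      have hx' : HasFDerivAt T (T' x) (x + (0 : ℝ) • (y - x)) := by simpa using hderiv x hx.1
      exact hx'.comp_hasDerivAt (0 : ℝ) hline
    have h7 : HasDerivWithinAt (fun r : ℝ => T (x + r • (y - x))) 0 (Icc 0 1) 0 := by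
      refine (hasDerivWithinAt_const (0 : ℝ) (Icc (0 : ℝ) 1) (T x)).congr (fun r hr => ?_) (by simp)
      simp only [hT, hP.apply_lineMap_eq h4 hr, hQ.apply_lineMap_eq h5 hr]
    have h8 : T' x (y - x) = 0 :=
      (uniqueDiffOn_Icc zero_lt_one 0 (left_mem_Icc.2 zero_le_one)).eq_deriv _
        h6.hasDerivWithinAt h7
    have h9 : IsUnit (T' x : E →ₗ[ℝ] E) :=
      (LinearMap.isUnit_iff_isUnit_det _).2 (isUnit_iff_ne_zero.2 hx.2)
    have h10 := ((Module.End.isUnit_iff _).1 h9).1 (h8.trans (map_zero (T' x)).symm)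
    exact hne (sub_eq_zero.1 h10).symm
  have hnull1 : μ (T '' Dᶜ) = 0 := by
    have hlip := hP.lipschitzWith.add ((lipschitzWith_smul t).comp hQ.lipschitzWith)
    exact hlip.addHaar_image_eq_zero μ (mem_ae_iff.1 hDae)
  have hnull2 : μ (T '' (D \ G)) = 0 := by
    refine addHaar_image_eq_zero_of_det_fderivWithin_eq_zero μ
      (fun x hx => (hderiv x hx.1).hasFDerivWithinAt) fun x hx => ?_
    by_contra h
    exact hx.2 ⟨hx.1, h⟩
  have hrange : range T ⊆ T '' G ∪ (T '' (D \ G) ∪ T '' Dᶜ) := by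
    rintro _ ⟨x, rfl⟩
    by_cases hxD : x ∈ D
    · by_cases hxG : x ∈ G
      · exact Or.inl (mem_image_of_mem _ hxG)
      · exact Or.inr (Or.inl (mem_image_of_mem _ ⟨hxD, hxG⟩))
    · exact Or.inr (Or.inr (mem_image_of_mem _ hxD))
  have hvol : μ (K + t • L) = μ (T '' G) := by
    apply le_antisymm
    · have h_int : μ (K + t • L) ≤ μ (interior (K + t • L)) := by
        refine measure_mono_ae ?_
        have hfr := (hKc.add (hLc.smul t)).addHaar_frontier μ
        filter_upwards [compl_mem_ae_iff.2 hfr] with x hx hmem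
        by_contra hx'
        exact hx ⟨subset_closure hmem, hx'⟩
      calc μ (K + t • L) ≤ μ (T '' G ∪ (T '' (D \ G) ∪ T '' Dᶜ)) :=
            h_int.trans (measure_mono ((hP.interior_subset_range hQ hKb hLb ht).trans hrange))
        _ ≤ μ (T '' G) + (μ (T '' (D \ G)) + μ (T '' Dᶜ)) :=
            (measure_union_le _ _).trans (add_le_add le_rfl (measure_union_le _ _))
        _ = μ (T '' G) := by rw [hnull1, hnull2, add_zero, add_zero]
    · exact measure_mono ((image_subset_range _ _).trans (hP.range_subset hQ t))
  rw [hvol, ← lintegral_abs_det_fderiv_eq_addHaar_image μ hGm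
    (fun x hx => (hderiv x hx.1).hasFDerivWithinAt) hinj, ← lintegral_indicator hGm]
  refine lintegral_congr_ae ?_
  filter_upwards [hDae] with x hx
  by_cases hxG : x ∈ G
  · rw [indicator_of_mem hxG, abs_of_nonneg (hdet x hx)]
  · rw [indicator_of_notMem hxG]
    have : (T' x).det = 0 := by
      by_contra h
      exact hxG ⟨hx, h⟩
    rw [this, ENNReal.ofReal_zero]

/-- Minkowski's theorem for two bodies: the volume of `K + t • L` is a polynomial in `t > 0`. -/
theorem exists_polynomial_addHaar_add_smul [MeasurableSpace E] [BorelSpace E]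
    (μ : Measure E) [μ.IsAddHaarMeasure] {K L : Set E} (hK : IsCompact K) (hL : IsCompact L)
    (hKc : Convex ℝ K) (hLc : Convex ℝ L) (hKne : K.Nonempty) (hLne : L.Nonempty) :
    ∃ p : Polynomial ℝ, p.degree < (Module.finrank ℝ E + 1 : ℕ) ∧
      ∀ t : ℝ, 0 < t → μ.real (K + t • L) = p.eval t := by
  obtain ⟨P, hP⟩ := exists_isNearestPointMap hKne hK.isComplete hKc
  obtain ⟨Q, hQ⟩ := exists_isNearestPointMap hLne hL.isComplete hLc
  set q : ℝ → E → ℝ := fun t x => (fderiv ℝ P x + t • fderiv ℝ Q x).det with hq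
  have hqm (t : ℝ) : Measurable (q t) :=
    ContinuousLinearMap.continuous_det.measurable.comp
      ((measurable_fderiv ℝ P).add ((measurable_fderiv ℝ Q).const_smul t))
  have hqnn (t : ℝ) (ht : 0 < t) : 0 ≤ᵐ[μ] q t := by
    filter_upwards [hP.lipschitzWith.ae_differentiableAt (μ := μ),
      hQ.lipschitzWith.ae_differentiableAt (μ := μ)] with x h1 h2
    exact hP.det_fderiv_add_smul_nonneg hQ h1 h2 ht.le
  have hvol (t : ℝ) (ht : 0 < t) : μ (K + t • L) = ∫⁻ x, ENNReal.ofReal (q t x) ∂μ :=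
    hP.addHaar_add_smul_eq_lintegral μ hQ hK.isBounded hL.isBounded hKc hLc ht
  have h_int (t : ℝ) (ht : 0 < t) : Integrable (q t) μ := by
    refine ⟨(hqm t).aestronglyMeasurable, ?_⟩
    rw [hasFiniteIntegral_iff_ofReal (hqnn t ht), ← hvol t ht]
    exact (hK.add (hL.smul t)).measure_lt_top
  have hreal (t : ℝ) (ht : 0 < t) : μ.real (K + t • L) = ∫ x, q t x ∂μ := by
    rw [integral_eq_lintegral_of_nonneg_ae (hqnn t ht) (hqm t).aestronglyMeasurable,
      ← hvol t ht, Measure.real]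
  set s := Finset.range (Module.finrank ℝ E + 1) with hs
  set v : ℕ → ℝ := fun i => (i : ℝ) + 1 with hv
  have hvpos (i : ℕ) : 0 < v i := by positivity
  have hvinj : InjOn v s := fun i _ j _ hij => by simpa [hv] using hij
  refine ⟨Lagrange.interpolate s v fun i => μ.real (K + v i • L), ?_, fun t ht => ?_⟩
  · simpa [hs] using Lagrange.degree_interpolate_lt (fun i => μ.real (K + v i • L)) hvinj
  have hlag (x : E) : q t x = ∑ i ∈ s, q (v i) x * (Lagrange.basis s v i).eval t := by
    obtain ⟨f, hfdeg, hf⟩ :=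
      ContinuousLinearMap.exists_polynomial_det_add_smul (fderiv ℝ P x) (fderiv ℝ Q x)
    have hdeg : f.degree < (s.card : ℕ) := by
      rw [hs, Finset.card_range]
      exact Polynomial.degree_le_natDegree.trans_lt
        (by exact_mod_cast Nat.lt_succ_of_le hfdeg)
    have h := congrArg (Polynomial.eval t) (Lagrange.eq_interpolate hvinj hdeg)
    rw [Lagrange.interpolate_apply, Polynomial.eval_finsetSum] at h
    simpa [hf, hq] using h
  rw [hreal t ht, integral_congr_ae (Filter.Eventually.of_forall hlag),
    integral_finsetSum _ fun i _ => (h_int _ (hvpos i)).mul_const _, Lagrange.interpolate_apply,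
    Polynomial.eval_finsetSum]
  refine Finset.sum_congr rfl fun i _ => ?_
  rw [integral_mul_const, ← hreal _ (hvpos i), Polynomial.eval_mul, Polynomial.eval_C]

end MixedVolume

section RogersShephard

variable {E : Type*} [NormedAddCommGroup E] [InnerProductSpace ℝ E] {K : Set E}

theorem Convex.sum_mem_card_smul (hK : Convex ℝ K) (hne : K.Nonempty) (J : Finset K) :
    (∑ x ∈ J, (x : E)) ∈ (J.card : ℝ) • K := by
  classical
  induction J using Finset.induction_on with
  | empty => simp [zero_smul_set hne]
  | insert a J ha ih =>
    rw [Finset.sum_insert ha, Finset.card_insert_of_notMem ha, Nat.cast_add, Nat.cast_one,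
      hK.add_smul (Nat.cast_nonneg _) zero_le_one, one_smul, add_comm (a : E)]
    exact add_mem_add ih a.2

variable [FiniteDimensional ℝ E]

/-- A compact convex set has a point of Minkowski asymmetry at most the dimension. -/
theorem IsCompact.exists_forall_smul_sub_mem_smul (hKc : IsCompact K) (hK : Convex ℝ K)
    (hne : K.Nonempty) :
    ∃ c : E, ∀ x ∈ K, ((Module.finrank ℝ E : ℝ) + 1) • c - x ∈ (Module.finrank ℝ E : ℝ) • K := by
  classical
  set n := Module.finrank ℝ E
  have hn : (n : ℝ) + 1 ≠ 0 := by positivity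
  set F : K → Set E := fun x => ((n : ℝ) + 1)⁻¹ • ((n : ℝ) • K + {(x : E)}) with hF
  have hmem (c : E) (x : K) : c ∈ F x ↔ ((n : ℝ) + 1) • c - x ∈ (n : ℝ) • K := by
    rw [hF, mem_inv_smul_set_iff₀ hn, add_singleton, mem_image]
    constructor
    · rintro ⟨y, hy, hyx⟩
      rwa [← hyx, add_sub_cancel_right]
    · exact fun h => ⟨_, h, sub_add_cancel _ _⟩
  obtain ⟨k, hk⟩ := hne
  obtain ⟨c, hc⟩ : (⋂ x, F x).Nonempty := by
    refine Convex.helly_theorem_compact' (𝕜 := ℝ)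
      (fun x => ((hK.smul _).add (convex_singleton _)).smul _)
      (fun x => ((hKc.smul _).add isCompact_singleton).smul _) fun I hI => ?_
    refine ⟨((n : ℝ) + 1)⁻¹ • (∑ x ∈ I, (x : E) + ((n : ℝ) + 1 - I.card) • k), ?_⟩
    refine mem_iInter₂.2 fun x hx => (hmem _ _).2 ?_
    have hcard : ((I.erase x).card : ℝ) = I.card - 1 := by
      rw [← Finset.card_erase_add_one hx]
      simp
    have hI' : (I.card : ℝ) ≤ n + 1 := by exact_mod_cast hI
    have e : (n : ℝ) = (I.erase x).card + ((n : ℝ) + 1 - I.card) := by rw [hcard]; ring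
    rw [smul_inv_smul₀ hn, ← Finset.sum_erase_add I _ hx, add_right_comm, add_sub_cancel_right]
    rw [congrArg (· • K) e, hK.add_smul (Nat.cast_nonneg _) (sub_nonneg.2 hI')]
    exact add_mem_add (hK.sum_mem_card_smul ⟨k, hk⟩ _) (smul_mem_smul_set hk)
  exact ⟨c, fun x hx => (hmem c ⟨x, hx⟩).1 (mem_iInter.1 hc ⟨x, hx⟩)⟩

variable [MeasurableSpace E] [BorelSpace E] (μ : Measure E) [μ.IsAddHaarMeasure]

theorem IsCompact.addHaar_add_smul_neg_le (hKc : IsCompact K) (hK : Convex ℝ K)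
    (hne : K.Nonempty) {t : ℝ} (ht : 0 ≤ t) :
    μ (K + t • (-K)) ≤
      ENNReal.ofReal ((1 + t * Module.finrank ℝ E) ^ Module.finrank ℝ E) * μ K := by
  obtain ⟨c, hc⟩ := hKc.exists_forall_smul_sub_mem_smul hK hne
  set n := Module.finrank ℝ E
  have hsub : K + t • (-K) ⊆ (-(t * (n + 1)) • c) +ᵥ ((1 + t * (n : ℝ)) • K) := by
    rintro _ ⟨x, hx, _, ⟨y, hy, rfl⟩, rfl⟩
    refine ⟨x + t • (((n : ℝ) + 1) • c - -y), ?_, ?_⟩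
    · rw [hK.add_smul zero_le_one (by positivity), one_smul, mul_smul]
      exact add_mem_add hx (smul_mem_smul_set (hc _ hy))
    · simp only [vadd_eq_add]
      module
  refine (measure_mono hsub).trans_eq ?_
  rw [measure_vadd, Measure.addHaar_smul_of_nonneg μ (by positivity)]

theorem lintegral_addHaar_inter_vadd (hKm : MeasurableSet K) :
    ∫⁻ x, μ (K ∩ (x +ᵥ K)) ∂μ = μ K * μ K := by
  have h (x : E) : μ (K ∩ (x +ᵥ K)) = ∫⁻ y, K.indicator 1 y * K.indicator 1 (y - x) ∂μ := by
    rw [← lintegral_indicator_one (hKm.inter (hKm.const_vadd x))]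
    congr 1 with y
    rw [inter_indicator_one, Pi.mul_apply]
    congr 1
    have hy : y ∈ x +ᵥ K ↔ y - x ∈ K := by
      rw [mem_vadd_set_iff_neg_vadd_mem, vadd_eq_add, neg_add_eq_sub]
    by_cases h : y - x ∈ K
    · rw [indicator_of_mem h, indicator_of_mem (hy.2 h), Pi.one_apply, Pi.one_apply]
    · rw [indicator_of_notMem h, indicator_of_notMem (mt hy.1 h)]
  have hm : Measurable (K.indicator (1 : E → ℝ≥0∞)) := measurable_one.indicator hKm
  simp_rw [h]
  rw [lintegral_lintegral_swap (by fun_prop)]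
  have h2 (y : E) : ∫⁻ x, K.indicator 1 y * K.indicator (1 : E → ℝ≥0∞) (y - x) ∂μ
      = K.indicator 1 y * μ K := by
    rw [lintegral_const_mul _ (by fun_prop), lintegral_sub_left_eq_self (μ := μ) (K.indicator 1) y,
      lintegral_indicator_one hKm]
  simp_rw [h2]
  rw [lintegral_mul_const _ hm, lintegral_indicator_one hKm]

theorem measurable_addHaar_inter_vadd (hKm : MeasurableSet K) :
    Measurable fun x : E => μ (K ∩ (x +ᵥ K)) := by
  have h (x : E) : K ∩ (x +ᵥ K) = Prod.mk x ⁻¹' {z : E × E | z.2 ∈ K ∧ z.2 - z.1 ∈ K} := by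
    ext y
    simp [mem_vadd_set_iff_neg_vadd_mem, neg_add_eq_sub]
  simp_rw [h]
  exact measurable_measure_prodMk_left
    ((measurable_snd hKm).inter ((measurable_snd.sub measurable_fst) hKm))

/-- The Rogers–Shephard inequality, with the constant in the form of a beta integral. -/
theorem IsCompact.ofReal_mul_addHaar_sub_le (hKc : IsCompact K) (hK : Convex ℝ K)
    (hpos : μ K ≠ 0) (hn : 0 < Module.finrank ℝ E) :
    ENNReal.ofReal (Module.finrank ℝ E *
      ∫ t in (0 : ℝ)..1, (1 - t) ^ Module.finrank ℝ E * t ^ (Module.finrank ℝ E - 1)) *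
      μ (K - K) ≤ μ K := by
  set n := Module.finrank ℝ E
  have hfin : μ K ≠ ∞ := hKc.measure_lt_top.ne
  have hVpos : 0 < μ.real K := ENNReal.toReal_pos hpos hfin
  have hKm := hKc.measurableSet
  have hn' : (n : ℝ) ≠ 0 := by positivity
  set ψ : E → ℝ := fun x => (μ.real (K ∩ (x +ᵥ K)) / μ.real K) ^ (n : ℝ)⁻¹ with hψ
  have hψnn (x : E) : 0 ≤ ψ x := by positivity
  have hψm : Measurable ψ :=
    ((measurable_addHaar_inter_vadd μ hKm).ennreal_toReal.div_const _).pow_const _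
  have hφ (x : E) : μ (K ∩ (x +ᵥ K)) = μ K * ENNReal.ofReal (ψ x ^ (n : ℝ)) := by
    rw [hψ, Real.rpow_inv_rpow (by positivity) hn', ← ENNReal.ofReal_toReal hfin,
      ← ENNReal.ofReal_mul ENNReal.toReal_nonneg, ← Measure.real, mul_div_cancel₀ _ hVpos.ne',
      Measure.real, ENNReal.ofReal_toReal (measure_ne_top_of_subset inter_subset_left hfin)]
  have hsup {t : ℝ} (ht : t ∈ Ioc (0 : ℝ) 1) :
      ENNReal.ofReal ((1 - t) ^ n) * μ (K - K) ≤ μ {x | t ≤ ψ x} := by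
    have h1t : 0 ≤ 1 - t := sub_nonneg.2 ht.2
    rw [← Measure.addHaar_smul_of_nonneg μ h1t]
    refine measure_mono ?_
    rintro _ ⟨_, ⟨k, hk, l, hl, rfl⟩, rfl⟩
    have hsub : ((1 - t) • k) +ᵥ (t • K) ⊆ K ∩ (((1 - t) • (k - l)) +ᵥ K) := by
      rintro _ ⟨_, ⟨z, hz, rfl⟩, rfl⟩
      refine ⟨hK hk hz h1t ht.1.le (by ring), ⟨_, hK hl hz h1t ht.1.le (by ring), ?_⟩⟩
      simp only [vadd_eq_add]
      module
    have h2 : t ^ n * μ.real K ≤ μ.real (K ∩ (((1 - t) • (k - l)) +ᵥ K)) := by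
      have h3 := ENNReal.toReal_mono (measure_ne_top_of_subset inter_subset_left hfin)
        (measure_mono (μ := μ) hsub)
      rwa [measure_vadd, Measure.addHaar_smul_of_nonneg μ ht.1.le, ENNReal.toReal_mul,
        ENNReal.toReal_ofReal (pow_nonneg ht.1.le _)] at h3
    change t ≤ ψ _
    rw [hψ, Real.le_rpow_inv_iff_of_pos ht.1.le (by positivity) (by positivity),
      Real.rpow_natCast, le_div_iff₀ hVpos]
    exact h2
  have hcake : μ K = ∫⁻ x, ENNReal.ofReal (ψ x ^ (n : ℝ)) ∂μ := by
    have h := lintegral_addHaar_inter_vadd μ hKm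
    simp_rw [hφ] at h
    rw [lintegral_const_mul _ (by fun_prop)] at h
    exact ((ENNReal.mul_right_inj hpos hfin).1 h).symm
  have h_int : ENNReal.ofReal (∫ t in (0 : ℝ)..1, (1 - t) ^ n * t ^ (n - 1)) =
      ∫⁻ t in Ioc (0 : ℝ) 1, ENNReal.ofReal ((1 - t) ^ n * t ^ (n - 1)) := by
    rw [intervalIntegral.integral_of_le zero_le_one]
    refine ofReal_integral_eq_lintegral_ofReal ?_ ?_
    · exact (Continuous.integrableOn_Ioc (by fun_prop))
    · filter_upwards [ae_restrict_mem measurableSet_Ioc] with t ht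
      exact mul_nonneg (pow_nonneg (sub_nonneg.2 ht.2) _) (pow_nonneg ht.1.le _)
  rw [ENNReal.ofReal_mul (Nat.cast_nonneg _), h_int, mul_assoc]
  conv_rhs => rw [hcake, lintegral_rpow_eq_lintegral_meas_le_mul μ
    (Filter.Eventually.of_forall hψnn) hψm.aemeasurable (p := n) (by positivity)]
  gcongr
  rw [← lintegral_mul_const _ (by fun_prop)]
  refine le_trans ?_ (lintegral_mono_set (Ioc_subset_Ioi_self : Ioc (0 : ℝ) 1 ⊆ Ioi 0))
  refine setLIntegral_mono' measurableSet_Ioc fun t ht => ?_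
  rw [ENNReal.ofReal_mul (pow_nonneg (sub_nonneg.2 ht.2) _), mul_right_comm]
  have e : t ^ ((n : ℝ) - 1) = t ^ (n - 1) := by
    rw [← Real.rpow_natCast, Nat.cast_pred hn]
  rw [e]
  gcongr
  exact hsup ht

end RogersShephard

section DimensionFive

theorem le_of_forall_pos_le {f g : ℝ → ℝ} (hf : Continuous f) (hg : Continuous g)
    (h : ∀ t, 0 < t → f t ≤ g t) : f 0 ≤ g 0 :=
  le_of_tendsto_of_tendsto ((hf.tendsto 0).mono_left (nhdsWithin_le_nhds (s := Ioi 0)))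
    ((hg.tendsto 0).mono_left nhdsWithin_le_nhds)
    (Filter.eventually_of_mem self_mem_nhdsWithin h)

/-- A palindromic quintic is bounded by the simplex polynomial as soon as its constant term, its
slope at zero and its value at one are. -/
theorem quintic_le_of_palindromic {f : ℝ → ℝ} {V : ℝ} (p : Polynomial ℝ) (hp : p.degree < (6 : ℕ))
    (hfp : ∀ t, 0 < t → f t = p.eval t) (hsymm : ∀ t, 0 < t → f t = t ^ 5 * f t⁻¹)
    (hlow : ∀ t, 0 < t → V ≤ f t) (hup : ∀ t, 0 < t → f t ≤ (1 + t * 5) ^ 5 * V)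
    (hone : f 1 ≤ 252 * V) {t : ℝ} (ht : 0 < t) :
    f t ≤ (1 + 25 * t + 100 * t ^ 2 + 100 * t ^ 3 + 25 * t ^ 4 + t ^ 5) * V := by
  obtain ⟨b₀, b₁, b₂, hb⟩ : ∃ b₀ b₁ b₂ : ℝ, ∀ t, 0 < t →
      f t = b₀ * (1 + t ^ 5) + b₁ * (t + t ^ 4) + b₂ * (t ^ 2 + t ^ 3) := by
    refine ⟨(p.coeff 0 + p.coeff 5) / 2, (p.coeff 1 + p.coeff 4) / 2,
      (p.coeff 2 + p.coeff 3) / 2, fun t ht => ?_⟩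
    have hev (x : ℝ) : p.eval x = ∑ i ∈ Finset.range 6, p.coeff i * x ^ i :=
      Polynomial.eval_eq_sum_range' (by
        rcases eq_or_ne p 0 with rfl | h0
        · simp
        · exact (Polynomial.natDegree_lt_iff_degree_lt h0).2 hp) x
    have h1 := hsymm t ht
    rw [hfp _ (inv_pos.2 ht), hev] at h1
    have h2 := hfp t ht
    rw [hev] at h2
    simp only [Finset.sum_range_succ, Finset.sum_range_zero] at h1 h2
    field_simp at h1
    linarith
  have hb₀ : b₀ = V := by
    refine le_antisymm ?_ ?_
    · have := le_of_forall_pos_le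
        (f := fun t => b₀ * (1 + t ^ 5) + b₁ * (t + t ^ 4) + b₂ * (t ^ 2 + t ^ 3))
        (g := fun t => (1 + t * 5) ^ 5 * V) (by fun_prop) (by fun_prop)
        fun t ht => hb t ht ▸ hup t ht
      simpa using this
    · have := le_of_forall_pos_le (f := fun _ => V)
        (g := fun t => b₀ * (1 + t ^ 5) + b₁ * (t + t ^ 4) + b₂ * (t ^ 2 + t ^ 3))
        (by fun_prop) (by fun_prop) fun t ht => hb t ht ▸ hlow t ht
      simpa using this
  subst hb₀
  have hb₁ : b₁ ≤ 25 * b₀ := by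
    have := le_of_forall_pos_le (f := fun t => b₀ * t ^ 4 + b₁ * (1 + t ^ 3) + b₂ * (t + t ^ 2))
      (g := fun t => (25 + 250 * t + 1250 * t ^ 2 + 3125 * t ^ 3 + 3125 * t ^ 4) * b₀)
      (by fun_prop) (by fun_prop) fun t ht => by
        have h := hb t ht ▸ hup t ht
        refine le_of_mul_le_mul_left ?_ ht
        linarith
    simpa using this
  have hsum : b₁ + b₂ ≤ 125 * b₀ := by
    have h := hb 1 one_pos ▸ hone
    linarith
  rw [hb t ht]
  have h1 : 0 ≤ t * (1 - t) ^ 2 * (1 + t) := by positivity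
  have h2 : 0 ≤ t ^ 2 + t ^ 3 := by positivity
  nlinarith [mul_le_mul_of_nonneg_right hb₁ h1, mul_le_mul_of_nonneg_right hsum h2]

theorem integral_one_sub_pow_five_mul_pow_four :
    ∫ t in (0 : ℝ)..1, (1 - t) ^ 5 * t ^ 4 = 1 / 1260 := by
  have e (t : ℝ) : (1 - t) ^ 5 * t ^ 4 =
      t ^ 4 - 5 * t ^ 5 + 10 * t ^ 6 - 10 * t ^ 7 + 5 * t ^ 8 - t ^ 9 := by ring
  have hd (t : ℝ) : HasDerivAt (fun t : ℝ => t ^ 5 / 5 - 5 * (t ^ 6 / 6) + 10 * (t ^ 7 / 7)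
      - 10 * (t ^ 8 / 8) + 5 * (t ^ 9 / 9) - t ^ 10 / 10) ((1 - t) ^ 5 * t ^ 4) t := by
    have hq (k : ℕ) := (hasDerivAt_pow (k + 1) t).div_const ((k : ℝ) + 1)
    have := (((((hq 4).sub ((hq 5).const_mul 5)).add ((hq 6).const_mul 10)).sub
      ((hq 7).const_mul 10)).add ((hq 8).const_mul 5)).sub (hq 9)
    refine (this.congr_deriv ?_).congr_of_eventuallyEq (Filter.Eventually.of_forall fun x => ?_)
    · rw [e]
      push_cast
      ring
    · simp only [Pi.add_apply, Pi.sub_apply]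
      push_cast
      ring
  rw [intervalIntegral.integral_eq_sub_of_hasDerivAt (fun t _ => hd t)
    (Continuous.intervalIntegrable (by fun_prop) _ _)]
  norm_num

theorem IsCompact.addHaar_real_sub_le_of_finrank_eq_five {E : Type*} [NormedAddCommGroup E]
    [InnerProductSpace ℝ E] [FiniteDimensional ℝ E] [MeasurableSpace E] [BorelSpace E]
    (μ : Measure E) [μ.IsAddHaarMeasure] {K : Set E} (hKc : IsCompact K) (hK : Convex ℝ K)
    (hpos : μ K ≠ 0) (hE : Module.finrank ℝ E = 5) : μ.real (K - K) ≤ 252 * μ.real K := by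
  have h := hKc.ofReal_mul_addHaar_sub_le μ hK hpos (by lia)
  rw [hE, Nat.add_one_sub_one, integral_one_sub_pow_five_mul_pow_four] at h
  have h' := ENNReal.toReal_mono hKc.measure_lt_top.ne h
  rw [ENNReal.toReal_mul, ENNReal.toReal_ofReal (by norm_num)] at h'
  norm_num at h'
  simp only [Measure.real]
  linarith

/-- The sharp bound for the volume of `K - t • K` in dimension five. -/
theorem IsCompact.addHaar_real_add_smul_neg_le_of_finrank_eq_five {E : Type*}
    [NormedAddCommGroup E] [InnerProductSpace ℝ E] [FiniteDimensional ℝ E] [MeasurableSpace E]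
    [BorelSpace E] (μ : Measure E) [μ.IsAddHaarMeasure] {K : Set E} (hKc : IsCompact K)
    (hK : Convex ℝ K) (hpos : μ K ≠ 0) (hE : Module.finrank ℝ E = 5) {t : ℝ} (ht : 0 < t) :
    μ.real (K + t • (-K)) ≤
      (1 + 25 * t + 100 * t ^ 2 + 100 * t ^ 3 + 25 * t ^ 4 + t ^ 5) * μ.real K := by
  have hne : K.Nonempty := nonempty_of_measure_ne_zero hpos
  have hfin (t : ℝ) : μ (K + t • (-K)) ≠ ∞ := (hKc.add (hKc.neg.smul t)).measure_lt_top.ne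
  obtain ⟨p, hp, hfp⟩ :=
    exists_polynomial_addHaar_add_smul μ hKc hKc.neg hK hK.neg hne hne.neg
  rw [hE] at hp
  refine quintic_le_of_palindromic p hp hfp (fun t ht => ?_) (fun t ht => ?_) (fun t ht => ?_) ?_ ht
  · have e : K + t • (-K) = -(t • (K + t⁻¹ • (-K))) := by
      rw [smul_add, smul_inv_smul₀ ht.ne', neg_add, neg_neg, add_comm, Set.smul_set_neg]
    rw [e, Measure.real, Measure.measure_neg, Measure.addHaar_smul_of_nonneg μ ht.le, hE,
      ENNReal.toReal_mul, ENNReal.toReal_ofReal (by positivity), Measure.real]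
  · obtain ⟨k, hk⟩ := hne
    have hsub : (t • (-k)) +ᵥ K ⊆ K + t • (-K) := by
      rintro _ ⟨x, hx, rfl⟩
      exact ⟨x, hx, _, smul_mem_smul_set (neg_mem_neg.2 hk), add_comm _ _⟩
    have h := ENNReal.toReal_mono (hfin t) (measure_mono (μ := μ) hsub)
    rwa [measure_vadd] at h
  · have h := ENNReal.toReal_mono (ENNReal.mul_ne_top ENNReal.ofReal_ne_top
      hKc.measure_lt_top.ne) (hKc.addHaar_add_smul_neg_le μ hK hne ht.le)
    rwa [ENNReal.toReal_mul, ENNReal.toReal_ofReal (by positivity), hE] at h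
  · rw [one_smul, ← sub_eq_add_neg]
    exact hKc.addHaar_real_sub_le_of_finrank_eq_five μ hK hpos hE

end DimensionFive

theorem unbalanced_RS_dim5 (K : Set (EuclideanSpace ℝ (Fin 5)))
    (hK_compact : IsCompact K) (hK_conv : Convex ℝ K)
    (hK_int : (interior K).Nonempty)
    (lam : ℝ) (hlam : lam ∈ Set.Icc (0:ℝ) 1) :
    volume ((1 - lam) • K + lam • (-K))
      ≤ ENNReal.ofReal
          ((1 - lam)^5 + 25 * lam * (1 - lam)^4 + 100 * lam^2 * (1 - lam)^3
            + 100 * lam^3 * (1 - lam)^2 + 25 * lam^4 * (1 - lam) + lam^5) * volume K := by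
  have hne : K.Nonempty := hK_int.mono interior_subset
  have hfin : volume K ≠ ∞ := hK_compact.measure_lt_top.ne
  have hpos : volume K ≠ 0 := (Measure.measure_pos_of_nonempty_interior _ hK_int).ne'
  rcases hlam.1.eq_or_lt with rfl | h0
  · simp [zero_smul_set hne.neg]
  rcases hlam.2.eq_or_lt with rfl | h1
  · simp [zero_smul_set hne]
  have h1' : 0 < 1 - lam := sub_pos.2 h1
  set t := lam / (1 - lam) with ht
  have e : (1 - lam) • K + lam • (-K) = (1 - lam) • (K + t • (-K)) := by
    rw [smul_add, smul_smul, ht, mul_div_cancel₀ _ h1'.ne']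
  have hE : Module.finrank ℝ (EuclideanSpace ℝ (Fin 5)) = 5 := by simp
  have h := hK_compact.addHaar_real_add_smul_neg_le_of_finrank_eq_five volume hK_conv hpos hE
    (t := t) (by positivity)
  have hfin' : volume (K + t • (-K)) ≠ ∞ :=
    (hK_compact.add (hK_compact.neg.smul t)).measure_lt_top.ne
  rw [e, Measure.addHaar_smul_of_nonneg _ h1'.le, hE, ← ENNReal.ofReal_toReal hfin',
    ← ENNReal.ofReal_toReal hfin, ← ENNReal.ofReal_mul (by positivity),
    ← ENNReal.ofReal_mul (by positivity)]
  refine ENNReal.ofReal_le_ofReal ((mul_le_mul_of_nonneg_left h (by positivity)).trans_eq ?_)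
  rw [Measure.real, ← mul_assoc]
  congr 1
  rw [ht]
  field_simp
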